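/- arXiv:math/0512619 — 3 statements merged into one kernel-verified Lean document; each statement's English description precedes it below -/
import Mathlib

section
/- Fix integers n ≥ 1, r ≥ 1, and i ≥ 1. Let G be an additive subgroup of the group of functions Fin r → ZMod n such that the cardinality of G is odd, and let S ⊆ Fin r with #S = 2i. Then the set B = {g ∈ G : (∀ j, g j ≠ 0 ↔ j ∈ S) and Σ_j (g j).val = i·n} contains no element g with g = −g, and the cardinality of B is even. -/
theorem Function.Involutive.even_natCard {α : Type*} [Finite α] {f : α → α}
    (hf : Function.Involutive f) (hfix : ∀ x, f x ≠ x) : Even (Nat.card α) := by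
  have := Fintype.ofFinite α
  have h : ∑ _x : α, (1 : ZMod 2) = 0 :=
    Finset.sum_involution (fun x _ => f x) (fun _ _ => by decide) (fun x _ _ => hfix x)
      (fun _ _ => Finset.mem_univ _) (fun x _ => hf x)
  rw [Nat.card_eq_fintype_card, ← ZMod.natCast_eq_zero_iff_even]
  simpa using h

theorem eq_zero_of_eq_neg_of_odd_natCard {A : Type*} [AddGroup A] (hodd : Odd (Nat.card A))
    {a : A} (ha : a = -a) : a = 0 := by
  have h2 : addOrderOf a ∣ 2 := addOrderOf_dvd_of_nsmul_eq_zero (by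
    rw [two_nsmul]; exact eq_neg_iff_add_eq_zero.mp ha)
  have h1 : addOrderOf a ∣ 1 :=
    hodd.coprime_two_left ▸ Nat.dvd_gcd h2 (addOrderOf_dvd_natCard a)
  exact AddMonoid.addOrderOf_eq_one_iff.mp (Nat.dvd_one.mp h1)

theorem ZMod.sum_val_neg_add_sum_val {n : ℕ} [NeZero n] {ι : Type*} [Fintype ι]
    (g : ι → ZMod n) (S : Finset ι) (hg : ∀ j, g j ≠ 0 ↔ j ∈ S) :
    ∑ j, (-g j).val + ∑ j, (g j).val = S.card * n := by
  classical
  have h (j : ι) : (-g j).val + (g j).val = if j ∈ S then n else 0 := by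
    have hlt := ZMod.val_lt (g j)
    by_cases h0 : g j = 0
    · simp [h0, ← hg]
    · rw [ZMod.neg_val, if_neg h0, if_pos ((hg j).mp h0)]
      omega
  simp [← Finset.sum_add_distrib, h]

/-- **Lemma 3.15 (ii).** If `G` is an abelian group of weight vectors of odd order and
`S` is a support of size `2i`, then the set `B = 𝔅_G(i, 2i; S)` of elements of `G` with
support exactly `S` and stationary age `i` contains no element `g` with `g = -g`, and
its cardinality is even. -/
theorem stationary_age_even_card (n r i : ℕ) (hn : 1 ≤ n) (hr : 1 ≤ r) (hi : 1 ≤ i)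
    (G : AddSubgroup (Fin r → ZMod n)) (hodd : Odd (Nat.card G))
    (S : Finset (Fin r)) (hS : S.card = 2 * i) :
    (¬ ∃ g ∈ {g : Fin r → ZMod n | g ∈ G ∧ (∀ j, g j ≠ 0 ↔ j ∈ S) ∧
        ∑ j, (g j).val = i * n}, g = -g) ∧
    Even (Nat.card ↥{g : Fin r → ZMod n | g ∈ G ∧ (∀ j, g j ≠ 0 ↔ j ∈ S) ∧
        ∑ j, (g j).val = i * n}) := by
  have : NeZero n := ⟨by omega⟩
  set B := {g : Fin r → ZMod n | g ∈ G ∧ (∀ j, g j ≠ 0 ↔ j ∈ S) ∧ ∑ j, (g j).val = i * n}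
  have hfix : ∀ g ∈ B, g ≠ -g := by
    rintro g ⟨hG, hsupp, -⟩ hg
    have h0 : (⟨g, hG⟩ : G) = 0 := eq_zero_of_eq_neg_of_odd_natCard hodd (Subtype.ext hg)
    obtain ⟨j, hj⟩ : S.Nonempty := Finset.card_pos.mp (by omega)
    exact (hsupp j).mpr hj (congrFun (congrArg Subtype.val h0) j)
  have hneg : ∀ g ∈ B, -g ∈ B := by
    rintro g ⟨hG, hsupp, hage⟩
    refine ⟨G.neg_mem hG, fun j => by simpa using hsupp j, ?_⟩
    have h := ZMod.sum_val_neg_add_sum_val g S hsupp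
    rw [hS, hage, mul_assoc, two_mul] at h
    exact Nat.add_right_cancel h
  refine ⟨fun ⟨g, hg, h⟩ => hfix g hg h, ?_⟩
  exact Function.Involutive.even_natCard (f := fun g : B => ⟨-g.1, hneg g.1 g.2⟩)
    (fun g => Subtype.ext (neg_neg g.1)) (fun g h => hfix g.1 g.2 (congrArg Subtype.val h).symm)
end

section
/- Let l ≥ 2 and α : Fin 4 → ℕ satisfy l ∣ α_1+α_2+α_3+α_4 (Gorenstein condition) and gcd(l, α_j : j ≠ i) = 1 for every i (smallness). Let ν_1, ν_2 be two distinct indices and {ν_3, ν_4} the complementary pair. Then the number of integers λ with 1 ≤ λ ≤ l−1 such that l ∣ λα_{ν_3}, l ∣ λα_{ν_4}, l ∤ λα_{ν_1}, l ∤ λα_{ν_2}, and [λα_{ν_1}]_l + [λα_{ν_2}]_l + [λα_{ν_3}]_l + [λα_{ν_4}]_l = l, equals gcd(α_{ν_3}, α_{ν_4}, l) − 1. (This is the number of junior elements of height 2 supported on {ν_1, ν_2} of the Gorenstein cyclic quotient singularity of type (1/l)(α_1,α_2,α_3,α_4).) -/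
/-- If no common divisor of `l` and the entries of `α` over `s` exceeds `1`, then `l` divides `m`
as soon as it divides `m * α i` for all `i ∈ s`. -/
lemma dvd_of_forall_dvd_mul_of_gcd_eq_one {ι : Type*} {s : Finset ι} {α : ι → ℕ} {l m : ℕ}
    (hs : Nat.gcd l (s.gcd α) = 1) (h : ∀ i ∈ s, l ∣ m * α i) : l ∣ m := by
  have key : l ∣ s.gcd fun i => m * α i := Finset.dvd_gcd h
  rw [Finset.gcd_mul_left, normalize_eq] at key
  exact Nat.Coprime.dvd_of_dvd_mul_right hs key

/-- Two nonzero remainders modulo `l` whose sum is divisible by `l` add up to `l`. -/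
lemma mod_add_mod_eq_of_dvd_add {l a b : ℕ} (hl : 0 < l) (ha : ¬ l ∣ a) (h : l ∣ a + b) :
    a % l + b % l = l := by
  have ha' : 0 < a % l := Nat.pos_of_ne_zero fun h0 => ha (Nat.dvd_of_mod_eq_zero h0)
  have h1 := Nat.mod_lt a hl
  have h2 := Nat.mod_lt b hl
  have h3 : l ∣ a % l + b % l := by
    rw [Nat.dvd_iff_mod_eq_zero, ← Nat.add_mod]
    exact Nat.mod_eq_zero_of_dvd h
  obtain ⟨c, hc⟩ := h3
  have hc0 : 0 < c := Nat.pos_of_ne_zero fun h0 => by subst h0; omega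
  have hc2 : c < 2 := by
    by_contra! hge
    have := Nat.mul_le_mul_left l hge
    omega
  have : c = 1 := by omega
  simpa [this] using hc

/-- `l` divides both `m * a` and `m * b` iff `l / gcd(a, b, l)` divides `m`. -/
lemma dvd_mul_and_dvd_mul_iff {l : ℕ} (hl : 0 < l) (a b m : ℕ) :
    l ∣ m * a ∧ l ∣ m * b ↔ l / Nat.gcd (Nat.gcd a b) l ∣ m := by
  rw [← Nat.dvd_gcd_iff, Nat.gcd_mul_left]
  obtain ⟨g, x, y, hg, hxy, hx, hy⟩ := Nat.exists_coprime' (m := Nat.gcd a b) (n := l)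
    (Nat.gcd_pos_of_pos_right _ hl)
  have hgcd : Nat.gcd (Nat.gcd a b) l = g := by
    rw [hx, hy, Nat.gcd_mul_right, hxy.gcd_eq_one, one_mul]
  rw [hgcd, hx, hy, Nat.mul_div_cancel _ hg, ← mul_assoc, Nat.mul_dvd_mul_iff_right hg]
  exact hxy.symm.dvd_mul_right

/-- There are `g - 1` positive multiples of `l / g` below `l`, for `g ∣ l`. -/
lemma card_filter_div_dvd {l g : ℕ} (hl : 0 < l) (hg : g ∣ l) :
    ((Finset.Icc 1 (l - 1)).filter fun m => l / g ∣ m).card = g - 1 := by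
  obtain ⟨k, rfl⟩ := hg
  have hg0 : 0 < g := Nat.pos_of_mul_pos_right hl
  have hk0 : 0 < k := Nat.pos_of_mul_pos_left hl
  rw [Nat.mul_div_cancel_left _ hg0]
  have : Finset.Icc 1 (g * k - 1) = Finset.Ioc 0 (g * k - 1) := by
    ext; simp [Nat.succ_le_iff]
  rw [this, Nat.Ioc_filter_dvd_card_eq_div]
  obtain ⟨n, rfl⟩ := Nat.exists_eq_succ_of_ne_zero hg0.ne'
  rw [Nat.succ_mul, Nat.add_sub_assoc hk0, Nat.mul_comm, Nat.mul_add_div hk0,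
    Nat.div_eq_of_lt (by omega)]
  simp

/-- **Number of junior elements of height `2` (formula (9.6)).** For a Gorenstein small
cyclic quotient singularity of type `(1/l)(α₁,α₂,α₃,α₄)` and distinct indices
`ν₁, ν₂` with complementary pair `{ν₃, ν₄}`, the number of junior group elements
supported exactly on `{ν₁, ν₂}` equals `gcd(α_{ν₃}, α_{ν₄}, l) - 1`. -/
theorem card_junior_height_two
    (l : ℕ) (hl : 2 ≤ l) (α : Fin 4 → ℕ)
    (hGor : l ∣ ∑ i, α i)
    (hsmall : ∀ i : Fin 4, Nat.gcd l (Finset.gcd (Finset.univ.erase i) α) = 1)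
    (ν₁ ν₂ ν₃ ν₄ : Fin 4) (h12 : ν₁ ≠ ν₂)
    (hcompl : ({ν₃, ν₄} : Finset (Fin 4)) = ({ν₁, ν₂} : Finset (Fin 4))ᶜ) :
    ((Finset.Icc 1 (l - 1)).filter fun lam =>
        l ∣ lam * α ν₃ ∧ l ∣ lam * α ν₄ ∧
        ¬ l ∣ lam * α ν₁ ∧ ¬ l ∣ lam * α ν₂ ∧
        (lam * α ν₁) % l + (lam * α ν₂) % l + (lam * α ν₃) % l + (lam * α ν₄) % l
          = l).card
      = Nat.gcd (Nat.gcd (α ν₃) (α ν₄)) l - 1 := by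
  have hl0 : 0 < l := by omega
  have hidx : ν₁ ≠ ν₃ ∧ ν₁ ≠ ν₄ ∧ ν₂ ≠ ν₃ ∧ ν₂ ≠ ν₄ ∧ ν₃ ≠ ν₄ ∧
      (∀ i, i = ν₁ ∨ i = ν₂ ∨ i = ν₃ ∨ i = ν₄) := by
    clear hsmall hGor
    revert ν₁ ν₂ ν₃ ν₄
    decide
  obtain ⟨h13, h14, h23, h24, h34, hall⟩ := hidx
  have hsum : ∑ i, α i = α ν₁ + α ν₂ + α ν₃ + α ν₄ := by
    have huniv : (Finset.univ : Finset (Fin 4)) = {ν₁, ν₂, ν₃, ν₄} := by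
      ext i
      simpa using hall i
    rw [huniv, Finset.sum_insert (by simp [h12, h13, h14]),
      Finset.sum_insert (by simp [h23, h24]), Finset.sum_pair h34]
    ring
  rw [← card_filter_div_dvd hl0 (Nat.gcd_dvd_right (Nat.gcd (α ν₃) (α ν₄)) l)]
  congr 1
  refine Finset.filter_congr fun m hm => ?_
  rw [← dvd_mul_and_dvd_mul_iff hl0]
  refine ⟨fun h => ⟨h.1, h.2.1⟩, fun ⟨h3, h4⟩ => ?_⟩
  have hm' : ¬ l ∣ m := by
    rw [Finset.mem_Icc] at hm
    exact Nat.not_dvd_of_pos_of_lt (by omega) (by omega)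
  have hn1 : ¬ l ∣ m * α ν₁ := fun h => hm' <|
    dvd_of_forall_dvd_mul_of_gcd_eq_one (hsmall ν₂) fun i hi => by
      rcases hall i with rfl | rfl | rfl | rfl <;> simp_all
  have hn2 : ¬ l ∣ m * α ν₂ := fun h => hm' <|
    dvd_of_forall_dvd_mul_of_gcd_eq_one (hsmall ν₁) fun i hi => by
      rcases hall i with rfl | rfl | rfl | rfl <;> simp_all
  refine ⟨h3, h4, hn1, hn2, ?_⟩
  have h12' : l ∣ m * α ν₁ + m * α ν₂ := by
    have h := hGor.mul_left m
    rw [hsum, mul_add, mul_add, mul_add] at h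
    exact (Nat.dvd_add_left h3).mp ((Nat.dvd_add_left h4).mp h)
  rw [Nat.mod_eq_zero_of_dvd h3, Nat.mod_eq_zero_of_dvd h4, add_zero, add_zero]
  exact mod_add_mod_eq_of_dvd_add hl0 hn1 h12'
end

section
/- Let l ≥ 2 and α : Fin 4 → ℕ satisfy l ∣ α_1+α_2+α_3+α_4 (Gorenstein condition) and gcd(l, α_j : j ≠ i) = 1 for every i (smallness). Let ν_1, ν_2, ν_3 be three distinct indices and ν_4 the remaining one. Then twice the number of integers λ with 1 ≤ λ ≤ l−1 such that l ∣ λα_{ν_4}, l ∤ λα_{ν_j} for j = 1,2,3, and Σ_{i=1}^{4} [λα_i]_l = l, equals gcd(α_{ν_4}, l) − Σ_{j=1}^{3} gcd(α_{ν_4}, α_{ν_j}, l) + 2. (Equivalently, the number of junior elements of height 3 supported on {ν_1,ν_2,ν_3} — i.e. the lattice points in the relative interior of the corresponding 2-face of the junior tetrahedron — equals ½[gcd(α_{ν_4},l) − Σ_j gcd(α_{ν_4},α_{ν_j},l)] + 1.) -/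
theorem card_Ioc_filter_dvd_mul (l a : ℕ) (hl : 0 < l) :
    ((Finset.Ioc 0 l).filter fun k => l ∣ k * a).card = Nat.gcd a l := by
  have hg : 0 < Nat.gcd a l := Nat.gcd_pos_of_pos_right a hl
  have key : ∀ k, l ∣ k * a ↔ l / Nat.gcd a l ∣ k := by
    intro k
    constructor
    · intro h
      have hco : Nat.Coprime (l / Nat.gcd a l) (a / Nat.gcd a l) :=
        (Nat.coprime_div_gcd_div_gcd hg).symm
      refine hco.dvd_of_dvd_mul_right ?_
      rw [← Nat.mul_div_assoc _ (Nat.gcd_dvd_left a l)]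
      exact Nat.div_dvd_div (Nat.gcd_dvd_right a l) h
    · intro h
      calc l = l / Nat.gcd a l * Nat.gcd a l :=
            (Nat.div_mul_cancel (Nat.gcd_dvd_right a l)).symm
        _ ∣ k * a := mul_dvd_mul h (Nat.gcd_dvd_left a l)
  simp only [key]
  rw [Nat.Ioc_filter_dvd_card_eq_div, Nat.div_div_self (Nat.gcd_dvd_right a l) hl.ne']

theorem card_Ioc_filter_dvd_mul_and (l a b : ℕ) (hl : 0 < l) :
    ((Finset.Ioc 0 l).filter fun k => l ∣ k * a ∧ l ∣ k * b).card
      = Nat.gcd (Nat.gcd a b) l := by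
  rw [← card_Ioc_filter_dvd_mul l _ hl]
  simp only [← Nat.gcd_mul_left, Nat.dvd_gcd_iff]

/-- Multiplication by the complementary element `l - k` negates residues modulo `l`. -/
theorem sub_mul_mod_add (l k a : ℕ) (hk : k ≤ l) (h : ¬ l ∣ k * a) :
    ((l - k) * a) % l + (k * a) % l = l := by
  have hl : 0 < l := by
    rcases Nat.eq_zero_or_pos l with rfl | hl
    · simp_all
    · exact hl
  have hsum : l ∣ ((l - k) * a) % l + (k * a) % l := by
    rw [Nat.dvd_iff_mod_eq_zero, ← Nat.add_mod, ← add_mul, Nat.sub_add_cancel hk,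
      Nat.mul_mod_right]
  have h1 := Nat.mod_lt ((l - k) * a) hl
  have h2 := Nat.mod_lt (k * a) hl
  have h3 : 0 < (k * a) % l := Nat.pos_of_ne_zero fun h0 => h (Nat.dvd_of_mod_eq_zero h0)
  obtain ⟨c, hc⟩ := hsum
  have : c = 1 := by
    have : c < 2 := by by_contra! h; nlinarith
    have : c ≠ 0 := by rintro rfl; simp at hc; omega
    omega
  subst this
  omega

theorem dvd_sub_mul_iff (l k a : ℕ) (hk : k ≤ l) : l ∣ (l - k) * a ↔ l ∣ k * a := by
  have h : l ∣ (l - k) * a + k * a := by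
    rw [← add_mul, Nat.sub_add_cancel hk]; exact dvd_mul_right _ _
  exact ⟨fun h' => (Nat.dvd_add_right h').1 h, fun h' => (Nat.dvd_add_left h').1 h⟩

/-- The involution `k ↦ l - k` exchanges ages `1` and `2` among elements of height `3`. -/
theorem two_mul_card_filter_age_one (l a b c d : ℕ) (h : l ∣ a + b + c + d) :
    2 * ((Finset.Icc 1 (l - 1)).filter fun k => l ∣ k * d ∧ ¬ l ∣ k * a ∧ ¬ l ∣ k * b ∧
        ¬ l ∣ k * c ∧ (k * a) % l + (k * b) % l + (k * c) % l + (k * d) % l = l).card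
      = ((Finset.Icc 1 (l - 1)).filter fun k => l ∣ k * d ∧ ¬ l ∣ k * a ∧ ¬ l ∣ k * b ∧
        ¬ l ∣ k * c).card := by
  set N := (Finset.Icc 1 (l - 1)).filter fun k => l ∣ k * d ∧ ¬ l ∣ k * a ∧ ¬ l ∣ k * b ∧
        ¬ l ∣ k * c with hN
  let s : ℕ → ℕ := fun k => (k * a) % l + (k * b) % l + (k * c) % l + (k * d) % l
  have hJ : ((Finset.Icc 1 (l - 1)).filter fun k => l ∣ k * d ∧ ¬ l ∣ k * a ∧ ¬ l ∣ k * b ∧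
        ¬ l ∣ k * c ∧ (k * a) % l + (k * b) % l + (k * c) % l + (k * d) % l = l)
      = N.filter fun k => s k = l := by
    ext k
    simp only [hN, s, Finset.mem_filter]
    tauto
  have hs : ∀ k ∈ N, s k = l ∨ s k = 2 * l := by
    intro k hk
    simp only [hN, Finset.mem_filter, Finset.mem_Icc] at hk
    obtain ⟨⟨hk1, hk2⟩, hd, ha, hb, hc⟩ := hk
    have hl : 0 < l := by omega
    have hdvd : l ∣ s k := by
      have : l ∣ k * a + k * b + k * c + k * d := by
        rw [← mul_add, ← mul_add, ← mul_add]; exact h.mul_left k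
      rw [Nat.dvd_iff_mod_eq_zero] at this ⊢
      simpa [s, Nat.add_mod] using this
    have h0 : (k * d) % l = 0 := Nat.mod_eq_zero_of_dvd hd
    have h1 := Nat.mod_lt (k * a) hl
    have h2 := Nat.mod_lt (k * b) hl
    have h3 := Nat.mod_lt (k * c) hl
    have h4 : 0 < (k * a) % l := Nat.pos_of_ne_zero fun h0 => ha (Nat.dvd_of_mod_eq_zero h0)
    obtain ⟨m, hm⟩ := hdvd
    have hlt : l * m < l * 3 := by simp only [← hm, s]; omega
    have hpos : 0 < l * m := by simp only [← hm, s]; omega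
    have hm3 : m < 3 := Nat.lt_of_mul_lt_mul_left hlt
    have hm0 : 0 < m := Nat.pos_of_mul_pos_left hpos
    interval_cases m <;> omega
  have hinv : ∀ k ∈ N, l - k ∈ N ∧ s (l - k) + s k = 3 * l ∧ l - (l - k) = k := by
    intro k hk
    simp only [hN, Finset.mem_filter, Finset.mem_Icc] at hk
    obtain ⟨⟨hk1, hk2⟩, hd, ha, hb, hc⟩ := hk
    have hkl : k ≤ l := by omega
    refine ⟨?_, ?_, by omega⟩
    · simp only [hN, Finset.mem_filter, Finset.mem_Icc, dvd_sub_mul_iff _ _ _ hkl]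
      exact ⟨⟨by omega, by omega⟩, hd, ha, hb, hc⟩
    · have h1 := sub_mul_mod_add l k a hkl ha
      have h2 := sub_mul_mod_add l k b hkl hb
      have h3 := sub_mul_mod_add l k c hkl hc
      have h4 := Nat.mod_eq_zero_of_dvd hd
      have h5 := Nat.mod_eq_zero_of_dvd ((dvd_sub_mul_iff l k d hkl).2 hd)
      simp only [s]
      omega
  have hcard : (N.filter fun k => s k = l).card = (N.filter fun k => ¬ s k = l).card := by
    refine Finset.card_nbij' (fun k => l - k) (fun k => l - k) ?_ ?_ ?_ ?_
    · intro k hk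
      simp only [Finset.coe_filter, Set.mem_ofPred_eq] at hk ⊢
      have hk1 : 1 ≤ k ∧ k ≤ l - 1 := Finset.mem_Icc.1 (Finset.mem_of_mem_filter k hk.1)
      have := hinv k hk.1
      exact ⟨this.1, by omega⟩
    · intro k hk
      simp only [Finset.coe_filter, Set.mem_ofPred_eq] at hk ⊢
      have := hinv k hk.1
      have := hs k hk.1
      exact ⟨by tauto, by omega⟩
    · exact fun k hk => (hinv k (Finset.mem_of_mem_filter k hk)).2.2
    · exact fun k hk => (hinv k (Finset.mem_of_mem_filter k hk)).2.2
  rw [hJ, ← Finset.card_filter_add_card_filter_not (s := N) (fun k => s k = l), ← hcard, two_mul]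

/-- Inclusion–exclusion for the elements of height `3`, where `hsmall` says that only the
identity fixes all coordinates. -/
theorem card_filter_height_three (l a b c d : ℕ) (hl : 0 < l) (h : l ∣ a + b + c + d)
    (hsmall : ∀ k, l ∣ k * a → l ∣ k * b → l ∣ k * c → l ∣ k * d → l ∣ k) :
    (((Finset.Icc 1 (l - 1)).filter fun k => l ∣ k * d ∧ ¬ l ∣ k * a ∧ ¬ l ∣ k * b ∧
        ¬ l ∣ k * c).card : ℤ)
      = (Nat.gcd d l : ℤ) - ((Nat.gcd (Nat.gcd d a) l : ℤ) + (Nat.gcd (Nat.gcd d b) l : ℤ)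
          + (Nat.gcd (Nat.gcd d c) l : ℤ)) + 2 := by
  have hext : ((Finset.Icc 1 (l - 1)).filter fun k => l ∣ k * d ∧ ¬ l ∣ k * a ∧
      ¬ l ∣ k * b ∧ ¬ l ∣ k * c)
      = (Finset.Ioc 0 l).filter fun k => l ∣ k * d ∧ ¬ l ∣ k * a ∧ ¬ l ∣ k * b ∧
        ¬ l ∣ k * c := by
    ext k
    simp only [Finset.mem_filter, Finset.mem_Icc, Finset.mem_Ioc]
    refine and_congr_left fun hk => ?_
    have : k ≠ l := by rintro rfl; exact hk.2.1 (dvd_mul_right _ _)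
    omega
  have hone : ((Finset.Ioc 0 l).filter fun k => k = l).card = 1 := by
    rw [Finset.filter_eq', if_pos (Finset.mem_Ioc.2 ⟨hl, le_rfl⟩), Finset.card_singleton]
  have htwo : (2 : ℤ) = 2 * ((Finset.Ioc 0 l).filter fun k => k = l).card := by
    rw [hone]; norm_num
  rw [hext, htwo, ← card_Ioc_filter_dvd_mul l d hl, ← card_Ioc_filter_dvd_mul_and l d a hl,
    ← card_Ioc_filter_dvd_mul_and l d b hl, ← card_Ioc_filter_dvd_mul_and l d c hl]
  simp only [Finset.card_filter, Nat.cast_sum, Finset.mul_sum, ← Finset.sum_add_distrib,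
    ← Finset.sum_sub_distrib]
  refine Finset.sum_congr rfl fun k hk => ?_
  rw [Finset.mem_Ioc] at hk
  have hsum : l ∣ k * a + k * b + k * c + k * d := by
    rw [← mul_add, ← mul_add, ← mul_add]; exact h.mul_left k
  have hkl : l ∣ k ↔ k = l :=
    ⟨fun hd => le_antisymm hk.2 (Nat.le_of_dvd hk.1 hd), fun e => e ▸ dvd_rfl⟩
  by_cases hd : l ∣ k * d
  · rw [Nat.dvd_add_left hd] at hsum
    have hab : l ∣ k * a → l ∣ k * b → k = l := fun ha hb =>
      hkl.1 (hsmall k ha hb ((Nat.dvd_add_right (dvd_add ha hb)).1 hsum) hd)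
    have hac : l ∣ k * a → l ∣ k * c → k = l := fun ha hc =>
      hkl.1 (hsmall k ha ((Nat.dvd_add_right ha).1 ((Nat.dvd_add_left hc).1 hsum)) hc hd)
    have hbc : l ∣ k * b → l ∣ k * c → k = l := fun hb hc =>
      hkl.1 (hsmall k ((Nat.dvd_add_left hb).1 ((Nat.dvd_add_left hc).1 hsum)) hb hc hd)
    by_cases e : k = l
    · simp [e]
    · by_cases ha : l ∣ k * a <;> by_cases hb : l ∣ k * b <;> by_cases hc : l ∣ k * c <;>
        simp_all
  · have e : k ≠ l := by rintro rfl; exact hd (dvd_mul_right _ _)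
    simp [hd, e]

/-- **Number of junior elements of height `3` (formula (9.7)).** For a Gorenstein small
cyclic quotient singularity of type `(1/l)(α₁,α₂,α₃,α₄)`, distinct indices
`ν₁, ν₂, ν₃` and remaining index `ν₄`, twice the number of junior group elements
supported exactly on `{ν₁, ν₂, ν₃}` (i.e. of the lattice points in the relative
interior of the corresponding `2`-face of the junior tetrahedron) equals
`gcd(α_{ν₄}, l) - Σ_{j=1}^{3} gcd(α_{ν₄}, α_{ν_j}, l) + 2`. -/
theorem card_junior_height_three
    (l : ℕ) (hl : 2 ≤ l) (α : Fin 4 → ℕ)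
    (hGor : l ∣ ∑ i, α i)
    (hsmall : ∀ i : Fin 4, Nat.gcd l (Finset.gcd (Finset.univ.erase i) α) = 1)
    (ν₁ ν₂ ν₃ ν₄ : Fin 4) (h12 : ν₁ ≠ ν₂) (h13 : ν₁ ≠ ν₃) (h23 : ν₂ ≠ ν₃)
    (hcompl : ({ν₄} : Finset (Fin 4)) = ({ν₁, ν₂, ν₃} : Finset (Fin 4))ᶜ) :
    (2 * ((Finset.Icc 1 (l - 1)).filter fun lam =>
        l ∣ lam * α ν₄ ∧
        ¬ l ∣ lam * α ν₁ ∧ ¬ l ∣ lam * α ν₂ ∧ ¬ l ∣ lam * α ν₃ ∧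
        (∑ i, (lam * α i) % l) = l).card : ℤ)
      = (Nat.gcd (α ν₄) l : ℤ)
        - ((Nat.gcd (Nat.gcd (α ν₄) (α ν₁)) l : ℤ)
            + (Nat.gcd (Nat.gcd (α ν₄) (α ν₂)) l : ℤ)
            + (Nat.gcd (Nat.gcd (α ν₄) (α ν₃)) l : ℤ))
        + 2 := by
  have hsum : ∀ f : Fin 4 → ℕ, ∑ i, f i = f ν₁ + f ν₂ + f ν₃ + f ν₄ := by
    intro f
    rw [← Finset.sum_add_sum_compl {ν₁, ν₂, ν₃}, ← hcompl, Finset.sum_singleton,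
      Finset.sum_insert (by simp [h12, h13]), Finset.sum_insert (by simp [h23]),
      Finset.sum_singleton]
    ring
  rw [hsum] at hGor
  have hfix : ∀ k, l ∣ k * α ν₁ → l ∣ k * α ν₂ → l ∣ k * α ν₃ → l ∣ k * α ν₄ → l ∣ k := by
    intro k h1 h2 h3 _
    have hg : l ∣ k * Finset.gcd (Finset.univ.erase ν₄) α := by
      have : l ∣ Finset.gcd (Finset.univ.erase ν₄) fun i => k * α i := by
        refine Finset.dvd_gcd fun i hi => ?_
        rw [← Finset.compl_singleton, hcompl, compl_compl] at hi
        simp only [Finset.mem_insert, Finset.mem_singleton] at hi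
        rcases hi with rfl | rfl | rfl <;> assumption
      rwa [Finset.gcd_mul_left, normalize_eq] at this
    exact Nat.Coprime.dvd_of_dvd_mul_right (hsmall ν₄) hg
  simp only [hsum]
  rw [← card_filter_height_three l _ _ _ _ (by omega) hGor hfix,
    ← two_mul_card_filter_age_one l _ _ _ _ hGor]
  push_cast
  rfl
end
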